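/- arXiv:math/9911242 — 2 statements merged into one kernel-verified Lean document; each statement's English description precedes it below -/
import Mathlib

section
/- Let C be an Ext-finite hereditary abelian category with a Serre functor, let P denote the class of projective objects, and let τ denote the Auslander–Reiten translate induced by the Serre functor. If U is an indecomposable object of C admitting a nonzero map φ : U → τ^{-a}P for some indecomposable projective P and some a ≥ 0, then U ≅ τ^{-b}Q for some indecomposable projective Q and some 0 ≤ b ≤ a. Consequently, every subobject of a preprojective object is preprojective. -/
open CategoryTheory CategoryTheory.Limits CategoryTheory.Pretriangulated

attribute [local instance] CategoryTheory.Abelian.hasFiniteBiproducts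

/-- A right Serre functor: an additive endofunctor `F` with isomorphisms
`Hom(X,Y) ≅ Hom(Y,FX)*` natural in both variables. -/
structure RightSerreFunctor (k : Type) [Field k] (A : Type) [Category A]
    [Preadditive A] [Linear k A] where
  F : A ⥤ A
  additive : F.Additive
  η : ∀ X Y : A, (X ⟶ Y) ≃ₗ[k] Module.Dual k (Y ⟶ F.obj X)
  nat_left : ∀ {X X' Y : A} (f : X' ⟶ X) (h : X ⟶ Y) (g : Y ⟶ F.obj X'),
    η X' Y (f ≫ h) g = η X Y h (g ≫ F.map f)
  nat_right : ∀ {X Y Y' : A} (h : X ⟶ Y) (g : Y ⟶ Y') (g' : Y' ⟶ F.obj X),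
    η X Y' (h ≫ g) g' = η X Y h (g ≫ g')

/-- `ι : C ⥤ T` realizes `T` as a model of the bounded derived category `D^b(C)`:
negative-degree morphisms out of the heart vanish, short exact sequences of `C` give
distinguished triangles, and every object of `T` is a finite direct sum of shifts of
objects of `C`. -/
def IsBoundedDerivedModel {C T : Type} [Category C] [Abelian C] [Category T]
    [Preadditive T] [HasZeroObject T] [HasFiniteBiproducts T] [HasShift T ℤ]
    [∀ n : ℤ, (CategoryTheory.shiftFunctor T n).Additive] [Pretriangulated T]
    (ι : C ⥤ T) : Prop :=
  (∀ (A B : C) (n : ℤ), n < 0 → ∀ f : ι.obj A ⟶ (ι.obj B)⟦n⟧, f = 0) ∧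
  (∀ S : ShortComplex C, S.ShortExact →
    ∃ δ : ι.obj S.X₃ ⟶ (ι.obj S.X₁)⟦(1 : ℤ)⟧,
      Triangle.mk (ι.map S.f) (ι.map S.g) δ ∈ distTriang T) ∧
  (∀ X : T, ∃ (n : ℕ) (obj : Fin n → C) (deg : Fin n → ℤ),
    Nonempty (X ≅ ⨁ fun i => (ι.obj (obj i))⟦deg i⟧))

/-- An object is indecomposable if it is nonzero and has no nontrivial idempotent
endomorphisms. -/
def Indec {C : Type} [Category C] [Limits.HasZeroMorphisms C] (X : C) : Prop :=
  ¬ Limits.IsZero X ∧ ∀ e : X ⟶ X, e ≫ e = e → e = 0 ∨ e = 𝟙 X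

/-- A short exact sequence `0 → X₁ → X₂ → X₃ → 0` is almost split if it does not split,
its end terms are indecomposable, and every map to `X₃` which is not a split
epimorphism factors through `X₂ → X₃`. -/
def IsAlmostSplitSeq {C : Type} [Category C] [Abelian C] (S : ShortComplex C) : Prop :=
  S.ShortExact ∧ (¬ ∃ s : S.X₃ ⟶ S.X₂, s ≫ S.g = 𝟙 S.X₃) ∧
  Indec S.X₁ ∧ Indec S.X₃ ∧
  ∀ (X : C) (t : X ⟶ S.X₃), ¬ IsSplitEpi t → ∃ u : X ⟶ S.X₂, u ≫ S.g = t

/-- `Y ≅ τ⁻¹ X`: there is an almost split sequence `0 → X → E → Y → 0`. -/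
def TauInvStep {C : Type} [Category C] [Abelian C] (X Y : C) : Prop :=
  ∃ S : ShortComplex C, IsAlmostSplitSeq S ∧ Nonempty (S.X₁ ≅ X) ∧ Nonempty (S.X₃ ≅ Y)

/-- `X ≅ τ^{-a} P`: a chain of `a` almost split sequences starting at `P`. -/
def TauInvChain {C : Type} [Category C] [Abelian C] (P X : C) (a : ℕ) : Prop :=
  ∃ ch : ℕ → C, Nonempty (ch 0 ≅ P) ∧ Nonempty (ch a ≅ X) ∧
    ∀ i < a, TauInvStep (ch i) (ch (i + 1))

/-- An object is preprojective if it is a finite direct sum of objects of the form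
`τ^{-a} P` with `P` indecomposable projective and `a ≥ 0`. -/
def Preprojective {C : Type} [Category C] [Abelian C] (X : C) : Prop :=
  ∃ (n : ℕ) (obj : Fin n → C),
    (∀ i, ∃ (P : C) (a : ℕ), Projective P ∧ Indec P ∧ TauInvChain P (obj i) a) ∧
    Nonempty (X ≅ ⨁ obj)

open Polynomial in
/-- Fitting's lemma for a finite-dimensional algebra with only trivial idempotents. -/
theorem isNilpotent_or_isUnit_of_trivial_idempotents (k : Type*) {A : Type*} [Field k] [Ring A]
    [Algebra k A] [FiniteDimensional k A] (h : ∀ e : A, e * e = e → e = 0 ∨ e = 1) (x : A) :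
    IsNilpotent x ∨ IsUnit x := by
  have hint : IsIntegral k x := Algebra.IsIntegral.isIntegral x
  have hp0 : minpoly k x * X ≠ 0 := mul_ne_zero (minpoly.ne_zero hint) X_ne_zero
  obtain ⟨q, hq, hndvd⟩ := exists_eq_pow_rootMultiplicity_mul_and_not_dvd _ hp0 0
  have hn : 0 < rootMultiplicity 0 (minpoly k x * X) := by
    rw [rootMultiplicity_pos hp0]
    simp
  generalize rootMultiplicity 0 (minpoly k x * X) = n at hq hn
  simp only [map_zero, sub_zero] at hq hndvd
  obtain ⟨a, b, hab⟩ : IsCoprime (X ^ n) q :=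
    ((irreducible_X (R := k)).coprime_iff_not_dvd.2 hndvd).pow_left
  have hzero : aeval x (X ^ n * q) = 0 := by
    rw [← hq]
    simp
  have hidem : aeval x (a * X ^ n) * aeval x (a * X ^ n) = aeval x (a * X ^ n) := by
    have h1 : a * X ^ n * (a * X ^ n) = a * X ^ n - a * b * (X ^ n * q) := by
      linear_combination (a * X ^ n) * hab
    rw [← map_mul, h1, map_sub, map_mul _ (a * b), hzero, mul_zero, sub_zero]
  rcases h _ hidem with he | he
  · left
    refine ⟨n, ?_⟩
    have h1 : (X : k[X]) ^ n = X ^ n * (a * X ^ n) + b * (X ^ n * q) := by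
      linear_combination -(X : k[X]) ^ n * hab
    have h2 := congrArg (aeval x) h1
    rwa [map_add, map_mul, he, map_mul _ b, hzero, mul_zero, mul_zero, add_zero, map_pow,
      aeval_X] at h2
  · right
    obtain ⟨m, rfl⟩ := Nat.exists_eq_succ_of_ne_zero hn.ne'
    have hl : aeval x (a * X ^ m) * x = 1 := by
      rw [← he, pow_succ, ← mul_assoc, map_mul _ (a * X ^ m), aeval_X]
    have hr : x * aeval x (a * X ^ m) = 1 := by
      have := congrArg (aeval x) (mul_comm X (a * X ^ m))
      rw [map_mul, map_mul _ (a * X ^ m), aeval_X] at this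
      rw [this, hl]
    exact ⟨⟨x, _, hr, hl⟩, rfl⟩

/-- A nontrivial finite-dimensional algebra with only trivial idempotents carries a nonzero
functional vanishing on all non-units. -/
theorem exists_dual_vanishing_on_nonunits (k : Type*) {A : Type*} [Field k] [Ring A] [Nontrivial A]
    [Algebra k A] [FiniteDimensional k A] (h : ∀ e : A, e * e = e → e = 0 ∨ e = 1) :
    ∃ l : Module.Dual k A, l ≠ 0 ∧ ∀ x, ¬ IsUnit x → l x = 0 := by
  have hfit := isNilpotent_or_isUnit_of_trivial_idempotents k h
  have hadd : ∀ x y : A, IsUnit (x + y) → IsUnit x ∨ IsUnit y := by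
    rintro x y ⟨u, hu⟩
    have hsum : (↑u⁻¹ : A) * y = 1 - ↑u⁻¹ * x := by
      rw [eq_sub_iff_add_eq, add_comm, ← mul_add, ← hu, Units.inv_mul]
    rcases hfit (↑u⁻¹ * x) with hx | hx
    · exact Or.inr ((Units.isUnit_units_mul u⁻¹ y).1 (hsum ▸ hx.isUnit_one_sub))
    · exact Or.inl ((Units.isUnit_units_mul u⁻¹ x).1 hx)
  let N : Submodule k A :=
    { carrier := {x | ¬ IsUnit x}
      add_mem' := fun {x y} hx hy hxy => (hadd x y hxy).elim hx hy
      zero_mem' := not_isUnit_zero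
      smul_mem' := fun c x hx hcx => by
        rcases eq_or_ne c 0 with rfl | hc
        · rw [zero_smul] at hcx
          exact not_isUnit_zero hcx
        · refine hx ?_
          have := ((hc.isUnit.inv).map (algebraMap k A)).mul hcx
          rwa [← Algebra.smul_def, smul_smul, inv_mul_cancel₀ hc, one_smul] at this }
  have h1 : (1 : A) ∉ N := fun h1 => h1 isUnit_one
  obtain ⟨l, hl1, hl⟩ := N.exists_dual_map_eq_bot_of_notMem h1 inferInstance
  refine ⟨l, fun h0 => hl1 (by simp [h0]), fun x hx => ?_⟩
  have : l x ∈ N.map l := ⟨x, hx, rfl⟩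
  simpa [hl] using this

section Indec

variable {C D : Type} [Category C] [Category D]

theorem Indec.of_iso [HasZeroMorphisms C] {X Y : C} (h : Indec X) (e : X ≅ Y) : Indec Y := by
  refine ⟨fun hY => h.1 (hY.of_iso e), fun f hf => ?_⟩
  have hidem : (e.hom ≫ f ≫ e.inv) ≫ e.hom ≫ f ≫ e.inv = e.hom ≫ f ≫ e.inv := by
    simp [reassoc_of% hf]
  have key : f = e.inv ≫ (e.hom ≫ f ≫ e.inv) ≫ e.hom := by simp
  rcases h.2 _ hidem with h0 | h0
  · left
    rw [key, h0]
    simp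
  · right
    rw [key, h0]
    simp

theorem Indec.map [HasZeroMorphisms C] [HasZeroMorphisms D] {X : C} (h : Indec X) (G : C ⥤ D)
    [G.PreservesZeroMorphisms] [G.Full] [G.Faithful] : Indec (G.obj X) := by
  refine ⟨fun h0 => h.1 (IsZero.of_full_of_faithful_of_isZero G _ h0), fun e he => ?_⟩
  obtain ⟨f, rfl⟩ := G.map_surjective e
  rw [← G.map_comp] at he
  rcases h.2 f (G.map_injective he) with rfl | rfl <;> simp

theorem Indec.of_map [HasZeroMorphisms C] [HasZeroMorphisms D] {X : C} (G : C ⥤ D)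
    [G.PreservesZeroMorphisms] [G.Full] [G.Faithful] (h : Indec (G.obj X)) : Indec X := by
  refine ⟨fun h0 => h.1 ?_, fun e he => ?_⟩
  · rw [IsZero.iff_id_eq_zero] at h0 ⊢
    rw [← G.map_id, h0, G.map_zero]
  · rcases h.2 (G.map e) (by rw [← G.map_comp, he]) with h0 | h0
    · exact Or.inl (G.map_injective (by rw [h0, G.map_zero]))
    · exact Or.inr (G.map_injective (by rw [h0, G.map_id]))

/-- An indecomposable finite biproduct is isomorphic to one of its summands. -/
theorem Indec.exists_iso_summand [Preadditive C] [HasFiniteBiproducts C] {X : C} (h : Indec X)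
    {n : ℕ} {f : Fin n → C} (e : X ≅ ⨁ f) : ∃ i, Nonempty (X ≅ f i) := by
  by_contra! hne
  have hzero : ∀ i, (e.hom ≫ biproduct.π f i) ≫ biproduct.ι f i ≫ e.inv = 0 := fun i => by
    refine (h.2 _ (by simp)).resolve_right fun h1 => ?_
    exact (hne i).false ⟨e.hom ≫ biproduct.π f i, biproduct.ι f i ≫ e.inv, h1, by simp⟩
  refine h.1 ((IsZero.iff_id_eq_zero X).2 ?_)
  calc 𝟙 X = e.hom ≫ 𝟙 (⨁ f) ≫ e.inv := by simp
    _ = ∑ i, (e.hom ≫ biproduct.π f i) ≫ biproduct.ι f i ≫ e.inv := by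
        rw [← biproduct.total]
        simp only [Preadditive.comp_sum, Preadditive.sum_comp, Category.assoc]
    _ = 0 := Finset.sum_eq_zero fun i _ => hzero i

theorem Indec.isNilpotent_or_isUnit (k : Type*) [Field k] [Preadditive C] [Linear k C] {X : C}
    (h : Indec X) [FiniteDimensional k (X ⟶ X)] (f : End X) : IsNilpotent f ∨ IsUnit f :=
  haveI : FiniteDimensional k (End X) := ‹FiniteDimensional k (X ⟶ X)›
  isNilpotent_or_isUnit_of_trivial_idempotents k (A := End X) (fun e he => h.2 e he) f

end Indec

/-- The universal map `X ⟶ F X` annihilated by every map to `X` that is not a split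
epimorphism. -/
theorem RightSerreFunctor.exists_almost_split_map {k : Type} [Field k] {A : Type} [Category A]
    [Preadditive A] [Linear k A] (S : RightSerreFunctor k A)
    (hfin : ∀ X Y : A, FiniteDimensional k (X ⟶ Y)) {X : A} (hX : Indec X) :
    ∃ d : X ⟶ S.F.obj X, d ≠ 0 ∧ ∀ (Y : A) (t : Y ⟶ X), ¬ IsSplitEpi t → t ≫ d = 0 := by
  have : FiniteDimensional k (End X) := hfin X X
  have : Nontrivial (End X) := ⟨⟨𝟙 X, 0, fun h => hX.1 ((IsZero.iff_id_eq_zero X).2 h)⟩⟩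
  obtain ⟨l, hl0, hl⟩ := exists_dual_vanishing_on_nonunits k (A := End X) (fun e he => hX.2 e he)
  have := hfin X (S.F.obj X)
  let m : Module.Dual k (Module.Dual k (X ⟶ S.F.obj X)) :=
    LinearMap.comp (M₂ := (X ⟶ X)) l (S.η X X).symm.toLinearMap
  have hd : ∀ f : X ⟶ X, S.η X X f ((Module.evalEquiv k _).symm m) = l f := fun f => by
    rw [Module.apply_evalEquiv_symm_apply]
    exact congrArg l ((S.η X X).symm_apply_apply f)
  refine ⟨(Module.evalEquiv k _).symm m, fun h0 => hl0 ?_, fun Y t ht => ?_⟩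
  · refine LinearMap.ext fun f => ?_
    have := hd f
    rw [h0, map_zero] at this
    exact this.symm
  · have := hfin Y (S.F.obj X)
    rw [← Module.forall_dual_apply_eq_zero_iff k]
    intro g
    obtain ⟨h, rfl⟩ := (S.η X Y).surjective g
    rw [← S.nat_right, hd]
    refine hl _ fun hu => ht ?_
    have : IsIso (h ≫ t) := (isUnit_iff_isIso (h ≫ t)).1 hu
    exact ⟨⟨⟨inv (h ≫ t) ≫ h, by simp⟩⟩⟩

section AlmostSplit

variable {C : Type} [Category C] [Abelian C]

theorem TauInvChain.of_iso {P X Y : C} {a : ℕ} (h : TauInvChain P X a) (e : X ≅ Y) :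
    TauInvChain P Y a := by
  obtain ⟨ch, h0, ⟨ha⟩, hs⟩ := h
  exact ⟨ch, h0, ⟨ha ≪≫ e⟩, hs⟩

theorem TauInvChain.zero (P : C) : TauInvChain P P 0 :=
  ⟨fun _ => P, ⟨Iso.refl _⟩, ⟨Iso.refl _⟩, fun _ h => absurd h (by omega)⟩

theorem TauInvStep.of_iso {X X' Y Y' : C} (h : TauInvStep X Y) (e : X ≅ X') (e' : Y ≅ Y') :
    TauInvStep X' Y' := by
  obtain ⟨S, hS, ⟨e₁⟩, ⟨e₃⟩⟩ := h
  exact ⟨S, hS, ⟨e₁ ≪≫ e⟩, ⟨e₃ ≪≫ e'⟩⟩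

theorem TauInvChain.succ {P X Y : C} {a : ℕ} (h : TauInvChain P X a) (hXY : TauInvStep X Y) :
    TauInvChain P Y (a + 1) := by
  obtain ⟨ch, ⟨h0⟩, ⟨ha⟩, hs⟩ := h
  refine ⟨fun n => if n ≤ a then ch n else Y, ⟨by simpa using h0⟩, ⟨by simpa using Iso.refl _⟩,
    fun i hi => ?_⟩
  rcases Nat.lt_succ_iff_lt_or_eq.1 hi with h | rfl
  · simpa [h.le, Nat.succ_le_of_lt h] using hs i h
  · simpa using hXY.of_iso ha.symm (Iso.refl _)

theorem TauInvStep.not_projective {X Y : C} (h : TauInvStep X Y) : ¬ Projective Y := by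
  intro hY
  obtain ⟨S, ⟨hS, hns, -⟩, -, ⟨e⟩⟩ := h
  have := hS.epi_g
  have : Projective S.X₃ := Projective.of_iso e.symm hY
  exact hns ⟨Projective.factorThru (𝟙 _) S.g, Projective.factorThru_comp _ _⟩

theorem IsAlmostSplitSeq.exists_lift {S S' : ShortComplex C} (hS : IsAlmostSplitSeq S)
    (hS' : IsAlmostSplitSeq S') (e : S.X₃ ≅ S'.X₃) :
    ∃ (u : S.X₂ ⟶ S'.X₂) (v : S.X₁ ⟶ S'.X₁), u ≫ S'.g = S.g ≫ e.hom ∧ v ≫ S'.f = S.f ≫ u := by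
  obtain ⟨u, hu⟩ := hS'.2.2.2.2 _ (S.g ≫ e.hom) fun h => hS.2.1
    ⟨e.hom ≫ section_ (S.g ≫ e.hom), by
      rw [← cancel_mono e.hom]
      simp⟩
  have := hS'.1.mono_f
  have h0 : (S.f ≫ u) ≫ S'.g = 0 := by rw [Category.assoc, hu, S.zero_assoc, zero_comp]
  exact ⟨u, hS'.1.exact.lift (S.f ≫ u) h0, hu, hS'.1.exact.lift_f _ _⟩

/-- The two ends of an almost split sequence cannot be connected by a nilpotent
endomorphism. -/
theorem IsAlmostSplitSeq.not_isNilpotent {S : ShortComplex C} (hS : IsAlmostSplitSeq S)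
    (u : End S.X₂) (v : End S.X₁) (hu : u ≫ S.g = S.g) (hv : v ≫ S.f = S.f ≫ u) :
    ¬ IsNilpotent v := by
  rintro ⟨n, hn⟩
  have hpow : ∀ m : ℕ, (u ^ m : End S.X₂) ≫ S.g = S.g ∧
      (v ^ m : End S.X₁) ≫ S.f = S.f ≫ (u ^ m : End S.X₂) := by
    intro m
    induction m with
    | zero => exact ⟨Category.id_comp _, (Category.id_comp _).trans (Category.comp_id _).symm⟩
    | succ m ih =>
      rw [pow_succ, pow_succ, End.mul_def, End.mul_def]
      refine ⟨by rw [Category.assoc, ih.1, hu], ?_⟩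
      rw [Category.assoc, ih.2, reassoc_of% hv]
  obtain ⟨h1, h2⟩ := hpow n
  rw [hn] at h2
  have h3 : S.f ≫ (u ^ n : End S.X₂) = 0 := by
    rw [← h2]
    exact zero_comp
  have := hS.1.epi_g
  refine hS.2.1 ⟨hS.1.exact.desc _ h3, ?_⟩
  rw [← cancel_epi S.g, hS.1.exact.g_desc_assoc, h1, Category.comp_id]

theorem TauInvStep.iso_left {X X' Y : C}
    (hfit : ∀ Z : C, Indec Z → ∀ f : End Z, IsNilpotent f ∨ IsUnit f)
    (h : TauInvStep X Y) (h' : TauInvStep X' Y) : Nonempty (X ≅ X') := by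
  obtain ⟨S, hS, ⟨e₁⟩, ⟨e₃⟩⟩ := h
  obtain ⟨S', hS', ⟨e₁'⟩, ⟨e₃'⟩⟩ := h'
  obtain ⟨u, v, hu, hv⟩ := hS.exists_lift hS' (e₃ ≪≫ e₃'.symm)
  obtain ⟨u', v', hu', hv'⟩ := hS'.exists_lift hS (e₃' ≪≫ e₃.symm)
  have hvv' : IsIso (v ≫ v') := (isUnit_iff_isIso _).1 ((hfit _ hS.2.2.1 _).resolve_left
    (hS.not_isNilpotent (u ≫ u') (v ≫ v') (by simp [hu', reassoc_of% hu])
      (by simp [hv', reassoc_of% hv])))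
  have hv'v : IsIso (v' ≫ v) := (isUnit_iff_isIso _).1 ((hfit _ hS'.2.2.1 _).resolve_left
    (hS'.not_isNilpotent (u' ≫ u) (v' ≫ v) (by simp [hu, reassoc_of% hu'])
      (by simp [hv, reassoc_of% hv'])))
  have : IsSplitMono v := ⟨⟨⟨v' ≫ inv (v ≫ v'), by simp [← Category.assoc]⟩⟩⟩
  have : IsSplitEpi v := ⟨⟨⟨inv (v' ≫ v) ≫ v', by simp⟩⟩⟩
  have : IsIso v := isIso_of_mono_of_isSplitEpi v
  exact ⟨e₁.symm ≪≫ asIso v ≪≫ e₁'⟩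

end AlmostSplit

section Decomposition

theorem finrank_end_lt_of_retract (k : Type*) [Field k] {A : Type*} [Category A] [Preadditive A]
    [Linear k A] {X Y : A} [FiniteDimensional k (X ⟶ X)] (i : Y ⟶ X) (p : X ⟶ Y)
    (hip : i ≫ p = 𝟙 Y) (hpi : p ≫ i ≠ 𝟙 X) :
    Module.finrank k (Y ⟶ Y) < Module.finrank k (X ⟶ X) := by
  let L : (Y ⟶ Y) →ₗ[k] (X ⟶ X) := (Linear.leftComp k X p).comp (Linear.rightComp k Y i)
  have hL : ∀ f, L f = p ≫ f ≫ i := fun f => rfl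
  have hinj : Function.Injective L := fun f g hfg => by
    have := congrArg (fun x => i ≫ x ≫ p) hfg
    simpa [hL, reassoc_of% hip, hip] using this
  rw [← LinearMap.finrank_range_of_inj hinj]
  refine Submodule.finrank_lt fun htop => hpi ?_
  obtain ⟨f, hf⟩ := LinearMap.range_eq_top.1 htop (𝟙 X)
  rw [hL] at hf
  calc p ≫ i = p ≫ i ≫ p ≫ f ≫ i := by rw [hf, Category.comp_id]
    _ = 𝟙 X := by rw [reassoc_of% hip, hf]

variable {C : Type} [Category C]

/-- If some natural number drops along proper retracts, every object is a finite direct sum of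
indecomposable objects. -/
theorem exists_indec_decomposition [Preadditive C] [IsIdempotentComplete C] [HasFiniteBiproducts C]
    (d : C → ℕ)
    (hd : ∀ {X Y : C} (i : Y ⟶ X) (p : X ⟶ Y), i ≫ p = 𝟙 Y → p ≫ i ≠ 𝟙 X → d Y < d X) (X : C) :
    ∃ (n : ℕ) (Y : Fin n → C), (∀ j, Indec (Y j)) ∧ Nonempty (X ≅ ⨁ Y) := by
  suffices H : ∀ (m : ℕ) (X : C), d X = m → ∃ (J : Type) (_ : Fintype J) (Y : J → C)
      (i : ∀ j, Y j ⟶ X) (p : ∀ j, X ⟶ Y j), (∀ j, Indec (Y j)) ∧ (∀ j, i j ≫ p j = 𝟙 _) ∧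
        (∀ j j', j ≠ j' → i j ≫ p j' = 0) ∧ ∑ j, p j ≫ i j = 𝟙 X by
    obtain ⟨J, _, Y, i, p, hY, hip, hip', htot⟩ := H _ X rfl
    let e := (Fintype.equivFin J).symm
    refine ⟨Fintype.card J, Y ∘ e, fun j => hY _, ⟨⟨biproduct.lift fun j => p (e j),
      biproduct.desc fun j => i (e j), ?_, ?_⟩⟩⟩
    · rw [biproduct.lift_desc, ← htot]
      exact Equiv.sum_comp e fun j => p j ≫ i j
    · refine biproduct.hom_ext' _ _ fun j => biproduct.hom_ext _ _ fun j' => ?_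
      simp only [biproduct.ι_desc_assoc, Category.assoc, biproduct.lift_π, Category.comp_id]
      rcases eq_or_ne j j' with rfl | hj
      · rw [biproduct.ι_π_self]
        exact hip _
      · rw [biproduct.ι_π_ne _ hj]
        exact hip' _ _ fun h => hj (e.injective h)
  intro m
  induction m using Nat.strong_induction_on with
  | _ m ih =>
    rintro X rfl
    by_cases hX0 : IsZero X
    · exact ⟨PEmpty, inferInstance, PEmpty.elim, fun j => j.elim, fun j => j.elim,
        fun j => j.elim, fun j => j.elim, fun j => j.elim, hX0.eq_of_src _ _⟩
    by_cases hX : Indec X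
    · exact ⟨Unit, inferInstance, fun _ => X, fun _ => 𝟙 X, fun _ => 𝟙 X, fun _ => hX,
        fun _ => Category.comp_id _, fun _ _ h => absurd rfl h, by simp⟩
    obtain ⟨e, he, he0, he1⟩ : ∃ e : X ⟶ X, e ≫ e = e ∧ e ≠ 0 ∧ e ≠ 𝟙 X := by
      simpa [Indec, hX0] using hX
    obtain ⟨Y, i, p, hip, hpi⟩ := IsIdempotentComplete.idempotents_split X e he
    obtain ⟨Z, i', p', hip₂, hpi₂⟩ := IsIdempotentComplete.idempotents_split X (𝟙 X - e)
      (Idempotents.idem_of_id_sub_idem e he)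
    have h12 : i ≫ p' = 0 := by
      have : i ≫ (p ≫ i) ≫ (p' ≫ i') ≫ p' = 0 := by
        rw [hpi, hpi₂]
        simp [reassoc_of% he]
      simpa [reassoc_of% hip, hip₂] using this
    have h21 : i' ≫ p = 0 := by
      have : i' ≫ (p' ≫ i') ≫ (p ≫ i) ≫ p = 0 := by
        rw [hpi, hpi₂]
        simp [reassoc_of% he]
      simpa [reassoc_of% hip₂, hip] using this
    obtain ⟨J, _, Y₁, i₁, p₁, a1, a2, a3, a4⟩ := ih _ (hd i p hip (hpi ▸ he1)) Y rfl
    obtain ⟨K, _, Y₂, i₂, p₂, b1, b2, b3, b4⟩ := ih _ (hd i' p' hip₂ (by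
      rw [hpi₂]
      simpa using he0)) Z rfl
    refine ⟨J ⊕ K, inferInstance, Sum.elim Y₁ Y₂, Sum.rec (fun j => i₁ j ≫ i) fun j => i₂ j ≫ i',
      Sum.rec (fun j => p ≫ p₁ j) fun j => p' ≫ p₂ j, ?_, ?_, ?_, ?_⟩
    · rintro (j | j)
      exacts [a1 j, b1 j]
    · rintro (j | j)
      · simp [reassoc_of% hip, a2]
      · simp [reassoc_of% hip₂, b2]
    · rintro (j | j) (j' | j') hj
      · change (i₁ j ≫ i) ≫ p ≫ p₁ j' = 0
        rw [Category.assoc, reassoc_of% hip]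
        exact a3 j j' fun h => hj (congrArg _ h)
      · change (i₁ j ≫ i) ≫ p' ≫ p₂ j' = 0
        rw [Category.assoc, reassoc_of% h12, zero_comp, comp_zero]
      · change (i₂ j ≫ i') ≫ p ≫ p₁ j' = 0
        rw [Category.assoc, reassoc_of% h21, zero_comp, comp_zero]
      · change (i₂ j ≫ i') ≫ p' ≫ p₂ j' = 0
        rw [Category.assoc, reassoc_of% hip₂]
        exact b3 j j' fun h => hj (congrArg _ h)
    · have h1 : ∑ j, (p ≫ p₁ j) ≫ i₁ j ≫ i = p ≫ (∑ j, p₁ j ≫ i₁ j) ≫ i := by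
        simp only [Preadditive.comp_sum, Preadditive.sum_comp, Category.assoc]
      have h2 : ∑ j, (p' ≫ p₂ j) ≫ i₂ j ≫ i' = p' ≫ (∑ j, p₂ j ≫ i₂ j) ≫ i' := by
        simp only [Preadditive.comp_sum, Preadditive.sum_comp, Category.assoc]
      rw [Fintype.sum_sum_type]
      change ∑ j, (p ≫ p₁ j) ≫ i₁ j ≫ i + ∑ j, (p' ≫ p₂ j) ≫ i₂ j ≫ i' = 𝟙 X
      rw [h1, h2, a4, b4, Category.id_comp, Category.id_comp, hpi, hpi₂]
      abel

end Decomposition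

section Triangle

variable {T : Type} [Category T] [Preadditive T] [HasZeroObject T] [HasShift T ℤ]
  [∀ n : ℤ, (CategoryTheory.shiftFunctor T n).Additive] [Pretriangulated T]
  {W X Y Z : T} {f : X ⟶ Y} {g : Y ⟶ Z} {δ : Z ⟶ X⟦(1 : ℤ)⟧}

theorem exists_lift_first_of_distTriang (hT : Triangle.mk f g δ ∈ distTriang T) (a : W ⟶ Y)
    (ha : a ≫ g = 0) : ∃ b : W ⟶ X, a = b ≫ f :=
  Triangle.coyoneda_exact₂ _ hT a ha

theorem exists_lift_second_of_distTriang (hT : Triangle.mk f g δ ∈ distTriang T) (a : W ⟶ Z)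
    (ha : a ≫ δ = 0) : ∃ b : W ⟶ Y, a = b ≫ g :=
  Triangle.coyoneda_exact₃ _ hT a ha

theorem exists_lift_third_of_distTriang (hT : Triangle.mk f g δ ∈ distTriang T)
    (a : W ⟶ X⟦(1 : ℤ)⟧) (ha : a ≫ f⟦(1 : ℤ)⟧' = 0) : ∃ b : W ⟶ Z, a = b ≫ δ :=
  Triangle.coyoneda_exact₁ _ hT a ha

theorem exists_desc_third_of_distTriang (hT : Triangle.mk f g δ ∈ distTriang T) (a : Y ⟶ W)
    (ha : f ≫ a = 0) : ∃ b : Z ⟶ W, a = g ≫ b :=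
  Triangle.yoneda_exact₂ _ hT a ha

theorem exists_desc_shift_of_distTriang (hT : Triangle.mk f g δ ∈ distTriang T) (a : Z ⟶ W)
    (ha : g ≫ a = 0) : ∃ b : X⟦(1 : ℤ)⟧ ⟶ W, a = δ ≫ b :=
  Triangle.yoneda_exact₃ _ hT a ha

end Triangle

section DerivedModel

variable {C T : Type} [Category C] [Abelian C] [Category T] [Preadditive T] [HasZeroObject T]
  [HasFiniteBiproducts T] [HasShift T ℤ] [∀ n : ℤ, (CategoryTheory.shiftFunctor T n).Additive]
  [Pretriangulated T] {ι : C ⥤ T}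

theorem IsBoundedDerivedModel.shift_hom_eq_zero (h : IsBoundedDerivedModel ι) {A B : C} {m n : ℤ}
    (hmn : n < m) (f : (ι.obj A)⟦m⟧ ⟶ (ι.obj B)⟦n⟧) : f = 0 := by
  refine (CategoryTheory.shiftFunctor T (-m)).map_injective ?_
  let e₁ := (shiftFunctorCompIsoId T m (-m) (add_neg_cancel m)).app (ι.obj A)
  let e₂ := (shiftFunctorAdd' T n (-m) (n - m) (sub_eq_add_neg n m).symm).app (ι.obj B)
  have h0 := h.1 A B (n - m) (by omega)
    (e₁.inv ≫ (CategoryTheory.shiftFunctor T (-m)).map f ≫ e₂.inv)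
  rwa [Preadditive.IsIso.comp_left_eq_zero, Preadditive.IsIso.comp_right_eq_zero,
    ← Functor.map_zero (CategoryTheory.shiftFunctor T (-m))] at h0

theorem IsBoundedDerivedModel.hom_of_shift_eq_zero (h : IsBoundedDerivedModel ι) {A B : C} {m : ℤ}
    (hm : 0 < m) (f : (ι.obj A)⟦m⟧ ⟶ ι.obj B) : f = 0 := by
  have := h.shift_hom_eq_zero hm (f ≫ (shiftFunctorZero T ℤ).inv.app (ι.obj B))
  rwa [Preadditive.IsIso.comp_right_eq_zero] at this

/-- A morphism `ι Z ⟶ (ι X)[1]` comes from a short exact sequence in `C`. -/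
theorem IsBoundedDerivedModel.exists_shortExact [ι.Additive] [ι.Full] [ι.Faithful]
    (h : IsBoundedDerivedModel ι) {X Z : C} (δ : ι.obj Z ⟶ (ι.obj X)⟦(1 : ℤ)⟧) :
    ∃ (E : C) (f : X ⟶ E) (g : E ⟶ Z) (w : f ≫ g = 0), (ShortComplex.mk f g w).ShortExact ∧
      Triangle.mk (ι.map f) (ι.map g) δ ∈ distTriang T := by
  obtain ⟨M, f, g, hT⟩ := distinguished_cocone_triangle₂ δ
  obtain ⟨n, obj, deg, ⟨e⟩⟩ := h.2.2 M
  have hsummand : ∀ i, ∃ E : C, Nonempty ((ι.obj (obj i))⟦deg i⟧ ≅ ι.obj E) := fun i => by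
    have hzero : IsZero ((ι.obj (obj i))⟦deg i⟧) →
        ∃ E : C, Nonempty ((ι.obj (obj i))⟦deg i⟧ ≅ ι.obj E) := fun h0 =>
      have ⟨Z, hZ⟩ := HasZeroObject.zero (C := C)
      ⟨Z, ⟨h0.iso (ι.map_isZero hZ)⟩⟩
    let j := biproduct.ι (fun i => (ι.obj (obj i))⟦deg i⟧) i ≫ e.inv
    let p := e.hom ≫ biproduct.π (fun i => (ι.obj (obj i))⟦deg i⟧) i
    have hjp : j ≫ p = 𝟙 _ := by simp [j, p]
    rcases lt_trichotomy (deg i) 0 with hi | hi | hi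
    · obtain ⟨p', hp'⟩ := exists_desc_third_of_distTriang hT p (h.1 _ _ _ hi _)
      have hp0 : p = 0 := by rw [hp', h.1 _ _ _ hi p', comp_zero]
      exact hzero ((IsZero.iff_id_eq_zero _).2 (by rw [← hjp, hp0, comp_zero]))
    · rw [hi]
      exact ⟨obj i, ⟨(shiftFunctorZero T ℤ).app _⟩⟩
    · obtain ⟨j', hj'⟩ := exists_lift_first_of_distTriang hT j (h.hom_of_shift_eq_zero hi _)
      have hj0 : j = 0 := by rw [hj', h.hom_of_shift_eq_zero hi j', zero_comp]
      exact hzero ((IsZero.iff_id_eq_zero _).2 (by rw [← hjp, hj0, zero_comp]))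
  choose E' hE' using hsummand
  let e' : M ≅ ι.obj (⨁ E') :=
    e ≪≫ biproduct.mapIso (fun i => (hE' i).some) ≪≫ (ι.mapBiproduct E').symm
  obtain ⟨f', hf'⟩ := ι.map_surjective (f ≫ e'.hom)
  obtain ⟨g', hg'⟩ := ι.map_surjective (e'.inv ≫ g)
  have hT' : Triangle.mk (ι.map f') (ι.map g') δ ∈ distTriang T :=
    isomorphic_distinguished _ hT _ (Triangle.isoMk _ _ (Iso.refl _) e'.symm (Iso.refl _)
      (by change ι.map f' ≫ e'.inv = 𝟙 _ ≫ f; simp [hf'])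
      (by change ι.map g' ≫ 𝟙 _ = e'.inv ≫ g; simp [hg'])
      (by change δ ≫ (𝟙 (ι.obj X))⟦(1 : ℤ)⟧' = 𝟙 _ ≫ δ; simp))
  have w : f' ≫ g' = 0 := ι.map_injective (by
    rw [ι.map_comp, ι.map_zero]
    exact comp_distTriang_mor_zero₁₂ _ hT')
  have : Mono f' := Preadditive.mono_of_cancel_zero _ fun {A} a ha => by
    obtain ⟨b, hb⟩ := exists_lift_third_of_distTriang hT' ((ι.map a)⟦(1 : ℤ)⟧') (by
      rw [← Functor.map_comp, ← ι.map_comp, ha, ι.map_zero, Functor.map_zero])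
    rw [h.hom_of_shift_eq_zero one_pos b, zero_comp, Functor.map_eq_zero_iff,
      Functor.map_eq_zero_iff] at hb
    exact hb
  have : Epi g' := Preadditive.epi_of_cancel_zero _ fun {A} a ha => by
    obtain ⟨b, hb⟩ := exists_desc_shift_of_distTriang hT' (ι.map a) (by
      rw [← ι.map_comp, ha, ι.map_zero])
    rwa [h.hom_of_shift_eq_zero one_pos b, comp_zero, Functor.map_eq_zero_iff] at hb
  have hker : IsLimit (KernelFork.ofι f' w) := KernelFork.IsLimit.ofι' f' w fun {A} a ha =>
    have hb := exists_lift_first_of_distTriang hT' (ι.map a) (by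
      rw [← ι.map_comp, ha, ι.map_zero])
    ⟨ι.preimage hb.choose, ι.map_injective (by
      rw [ι.map_comp, ι.map_preimage]
      exact hb.choose_spec.symm)⟩
  exact ⟨_, f', g', w, { exact := ShortComplex.exact_of_f_is_kernel _ hker }, hT'⟩

theorem IsBoundedDerivedModel.projective_of_ext_eq_zero [ι.Full] [ι.Faithful]
    (h : IsBoundedDerivedModel ι) {U : C}
    (hU : ∀ (Y : C) (f : ι.obj U ⟶ (ι.obj Y)⟦(1 : ℤ)⟧), f = 0) : Projective U where
  factors {A B} f g _ := by
    have hS : (ShortComplex.mk (kernel.ι g) g (kernel.condition g)).ShortExact :=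
      { exact := ShortComplex.exact_of_f_is_kernel _ (kernelIsKernel g) }
    obtain ⟨δ, hδ⟩ : ∃ δ : ι.obj B ⟶ (ι.obj (kernel g))⟦(1 : ℤ)⟧,
        Triangle.mk (ι.map (kernel.ι g)) (ι.map g) δ ∈ distTriang T := h.2.1 _ hS
    obtain ⟨t, ht⟩ := exists_lift_second_of_distTriang hδ (ι.map f) (hU _ _)
    exact ⟨ι.preimage t, ι.map_injective (by
      rw [ι.map_comp, ι.map_preimage]
      exact ht.symm)⟩

variable {k : Type} [Field k] [Linear k T] [ι.Additive] [ι.Full] [ι.Faithful]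

/-- The Serre functor sends an indecomposable object of the heart to the heart if it is
projective, and to the shift by one of an inverse image under `TauInvStep` otherwise. -/
theorem IsBoundedDerivedModel.serre_dichotomy (h : IsBoundedDerivedModel ι)
    (hfin : ∀ X Y : T, FiniteDimensional k (X ⟶ Y))
    (hher : ∀ (A B : C) (n : ℤ), 2 ≤ n → ∀ f : ι.obj A ⟶ (ι.obj B)⟦n⟧, f = 0)
    (S : RightSerreFunctor k T) [S.F.IsEquivalence] {U : C} (hU : Indec U) :
    (Projective U ∧ ∃ X : C, Nonempty (S.F.obj (ι.obj U) ≅ ι.obj X)) ∨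
    ∃ X : C, Indec X ∧ Nonempty (S.F.obj (ι.obj U) ≅ (ι.obj X)⟦(1 : ℤ)⟧) ∧ TauInvStep X U := by
  have := S.additive
  have hFU : Indec (S.F.obj (ι.obj U)) := (hU.map ι).map S.F
  obtain ⟨n, obj, deg, ⟨e⟩⟩ := h.2.2 (S.F.obj (ι.obj U))
  obtain ⟨i, ⟨e⟩⟩ := hFU.exists_iso_summand e
  obtain ⟨δ, hδ0, hδ⟩ := S.exists_almost_split_map hfin (hU.map ι)
  have hδe : δ ≫ e.hom ≠ 0 := by rwa [ne_eq, Preadditive.IsIso.comp_right_eq_zero]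
  generalize deg i = m at e hδe
  generalize obj i = X at e hδe
  have hm0 : 0 ≤ m := not_lt.1 fun hm => hδe (h.1 _ _ _ hm _)
  have hm1 : m < 2 := not_le.1 fun hm => hδe (hher _ _ _ hm _)
  obtain rfl | rfl : m = 0 ∨ m = 1 := by omega
  · left
    refine ⟨h.projective_of_ext_eq_zero fun Y f => (S.η _ _).injective ?_,
      X, ⟨e ≪≫ (shiftFunctorZero T ℤ).app _⟩⟩
    refine LinearMap.ext fun g => ?_
    have hg : g ≫ e.hom = 0 := h.shift_hom_eq_zero one_pos _
    rw [Preadditive.IsIso.comp_right_eq_zero] at hg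
    rw [hg, map_zero, map_zero]
  · right
    have hX : Indec X := ((hFU.of_iso e).of_map (CategoryTheory.shiftFunctor T (1 : ℤ))).of_map ι
    obtain ⟨E, f, g, w, hS, hT⟩ := h.exists_shortExact (δ ≫ e.hom)
    have hlift : ∀ (A : C) (t : A ⟶ U), ι.map t ≫ δ = 0 → ∃ u : A ⟶ E, u ≫ g = t := by
      intro A t ht
      obtain ⟨u, hu⟩ := exists_lift_second_of_distTriang hT (ι.map t) (by
        rw [reassoc_of% ht, zero_comp])
      exact ⟨ι.preimage u, ι.map_injective (by
        rw [ι.map_comp, ι.map_preimage]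
        exact hu.symm)⟩
    refine ⟨X, hX, ⟨e⟩, _, ⟨hS, ?_, hX, hU, fun A t ht => hlift A t (hδ _ _ fun hs => ht ?_)⟩,
      ⟨Iso.refl _⟩, ⟨Iso.refl _⟩⟩
    · rintro ⟨s, hs⟩
      refine hδe ?_
      have h1 : ι.map s ≫ ι.map g = 𝟙 _ := by
        rw [← ι.map_comp]
        exact (congrArg ι.map hs).trans (ι.map_id U)
      have h2 : ι.map g ≫ δ ≫ e.hom = 0 := comp_distTriang_mor_zero₂₃ _ hT
      rw [← Category.id_comp (δ ≫ e.hom), ← h1, Category.assoc, h2, comp_zero]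
    · exact ⟨⟨⟨ι.preimage (section_ (ι.map t)), ι.map_injective (by simp)⟩⟩⟩

theorem IsBoundedDerivedModel.exists_tauInvChain_of_hom (h : IsBoundedDerivedModel ι)
    (hfin : ∀ X Y : T, FiniteDimensional k (X ⟶ Y))
    (hher : ∀ (A B : C) (n : ℤ), 2 ≤ n → ∀ f : ι.obj A ⟶ (ι.obj B)⟦n⟧, f = 0)
    (S : RightSerreFunctor k T) [S.F.IsEquivalence] {P : C} (hP : Projective P) (hPi : Indec P)
    (a : ℕ) : ∀ {U V : C}, Indec U → TauInvChain P V a → ∀ φ : U ⟶ V, φ ≠ 0 →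
      ∃ (Q : C) (b : ℕ), Projective Q ∧ Indec Q ∧ b ≤ a ∧ TauInvChain Q U b := by
  have := S.additive
  have hfit : ∀ Z : C, Indec Z → ∀ f : End Z, IsNilpotent f ∨ IsUnit f := fun Z hZ f => by
    have := hfin (ι.obj Z) (ι.obj Z)
    let E : End Z ≃* End (ι.obj Z) := (Functor.FullyFaithful.ofFullyFaithful ι).mulEquivEnd Z
    refine ((hZ.map ι).isNilpotent_or_isUnit k (E f)).imp ?_ (isUnit_map_iff E f).1
    rintro ⟨n, hn⟩
    exact ⟨n, E.injective (by rw [map_pow, hn]; exact (ι.map_zero Z Z).symm)⟩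
  induction a with
  | zero =>
    intro U V hU ⟨ch, ⟨e0⟩, ⟨e0'⟩, _⟩ φ hφ
    rcases h.serre_dichotomy hfin hher S hU with ⟨hUp, -⟩ | ⟨X, hX, ⟨eX⟩, -⟩
    · exact ⟨U, 0, hUp, hU, le_rfl, TauInvChain.zero U⟩
    exfalso
    rcases h.serre_dichotomy hfin hher S hPi with ⟨-, Y, ⟨eY⟩⟩ | ⟨Y, -, -, hY⟩
    · let ψ := φ ≫ e0'.inv ≫ e0.hom
      have h0 : eX.inv ≫ S.F.map (ι.map ψ) ≫ eY.hom = 0 := h.hom_of_shift_eq_zero one_pos _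
      rw [Preadditive.IsIso.comp_left_eq_zero, Preadditive.IsIso.comp_right_eq_zero,
        Functor.map_eq_zero_iff, Functor.map_eq_zero_iff, Preadditive.IsIso.comp_right_eq_zero]
        at h0
      exact hφ h0
    · exact hY.not_projective hP
  | succ a ih =>
    intro U V hU ⟨ch, e0, ⟨ea⟩, hs⟩ φ hφ
    rcases h.serre_dichotomy hfin hher S hU with ⟨hUp, -⟩ | ⟨X, hX, ⟨eX⟩, hXU⟩
    · exact ⟨U, 0, hUp, hU, Nat.zero_le _, TauInvChain.zero U⟩
    have hstep : TauInvStep (ch a) V := (hs a a.lt_succ_self).of_iso (Iso.refl _) ea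
    have hV : Indec V := by
      obtain ⟨S', hS', -, ⟨e⟩⟩ := hstep
      exact hS'.2.2.2.1.of_iso e
    rcases h.serre_dichotomy hfin hher S hV with ⟨hVp, -⟩ | ⟨Y, hY, ⟨eY⟩, hYV⟩
    · exact absurd hVp hstep.not_projective
    obtain ⟨eW⟩ := hstep.iso_left hfit hYV
    obtain ⟨ψ', hψ'⟩ := (CategoryTheory.shiftFunctor T (1 : ℤ)).map_surjective
      (eX.inv ≫ S.F.map (ι.map φ) ≫ eY.hom)
    obtain ⟨ψ, rfl⟩ := ι.map_surjective ψ'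
    have hψ : ψ ≠ 0 := by
      rintro rfl
      rw [ι.map_zero, Functor.map_zero, eq_comm, Preadditive.IsIso.comp_left_eq_zero,
        Preadditive.IsIso.comp_right_eq_zero, Functor.map_eq_zero_iff, Functor.map_eq_zero_iff]
        at hψ'
      exact hφ hψ'
    obtain ⟨Q, b, hQ, hQi, hb, hch⟩ := ih hX
      ⟨ch, e0, ⟨eW⟩, fun i hi => hs i (hi.trans a.lt_succ_self)⟩ ψ hψ
    exact ⟨Q, b + 1, hQ, hQi, Nat.succ_le_succ hb, hch.succ hXU⟩

end DerivedModel

/-- Let `C` be an Ext-finite hereditary abelian `k`-category with Serre functor (a right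
Serre functor on a model `T` of `D^b(C)` which is an equivalence).  If `U` is
indecomposable and there is a nonzero map `φ : U ⟶ V` where `V ≅ τ^{-a}P` for an
indecomposable projective `P`, then `U ≅ τ^{-b}Q` for some indecomposable projective
`Q` and some `b ≤ a`.  Consequently every subobject of a preprojective object is
preprojective. -/
theorem hom_to_preprojective (k : Type) [Field k]
    (C : Type) [Category C] [Abelian C] [Linear k C]
    (T : Type) [Category T] [Preadditive T] [Linear k T] [HasZeroObject T]
    [HasFiniteBiproducts T] [HasShift T ℤ]
    [∀ n : ℤ, (CategoryTheory.shiftFunctor T n).Additive] [Pretriangulated T]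
    (ι : C ⥤ T) [ι.Additive] [ι.Full] [ι.Faithful]
    (hmodel : IsBoundedDerivedModel ι)
    (hfin : ∀ X Y : T, FiniteDimensional k (X ⟶ Y))
    (hher : ∀ (A B : C) (n : ℤ), 2 ≤ n → ∀ f : ι.obj A ⟶ (ι.obj B)⟦n⟧, f = 0)
    (S : RightSerreFunctor k T) (hS : S.F.IsEquivalence) :
    (∀ (U V P : C) (a : ℕ), Indec U → Projective P → Indec P → TauInvChain P V a →
      ∀ φ : U ⟶ V, φ ≠ 0 →
        ∃ (Q : C) (b : ℕ), Projective Q ∧ Indec Q ∧ b ≤ a ∧ TauInvChain Q U b) ∧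
    (∀ (X Y : C) (f : X ⟶ Y), Mono f → Preprojective Y → Preprojective X) := by
  have h₁ := fun (U V P : C) (a : ℕ) (hU : Indec U) (hP : Projective P) (hPi : Indec P)
    (hV : TauInvChain P V a) => hmodel.exists_tauInvChain_of_hom hfin hher S hP hPi a hU hV
  refine ⟨h₁, fun X Y f _ ⟨n, obj, hobj, ⟨e⟩⟩ => ?_⟩
  obtain ⟨m, Z, hZ, ⟨eX⟩⟩ := exists_indec_decomposition
    (fun X : C => Module.finrank k (ι.obj X ⟶ ι.obj X)) (fun {X Y} i p hip hpi => by
      have := hfin (ι.obj X) (ι.obj X)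
      refine finrank_end_lt_of_retract k (ι.map i) (ι.map p) ?_ fun h0 => hpi ?_
      · rw [← ι.map_comp, hip, ι.map_id]
      · exact ι.map_injective (by rw [ι.map_comp, h0, ι.map_id])) X
  refine ⟨m, Z, fun j => ?_, ⟨eX⟩⟩
  let φ : Z j ⟶ ⨁ obj := biproduct.ι Z j ≫ eX.inv ≫ f ≫ e.hom
  obtain ⟨i, hi⟩ : ∃ i, φ ≫ biproduct.π obj i ≠ 0 := by
    by_contra! h0
    have hφ : φ = 0 := biproduct.hom_ext _ _ fun i => by rw [h0 i, zero_comp]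
    refine (hZ j).1 ((IsZero.iff_id_eq_zero _).2 ?_)
    rw [← cancel_mono φ, hφ, comp_zero, comp_zero]
  obtain ⟨P, a, hP, hPi, hch⟩ := hobj i
  obtain ⟨Q, b, hQ, hQi, -, hQch⟩ := h₁ (Z j) (obj i) P a (hZ j) hP hPi hch _ hi
  exact ⟨Q, b, hQ, hQi, hQch⟩
end

section
/- Let A be a Grothendieck category and C a stable localizing subcategory of A (a localizing subcategory closed under injective hulls). Then the quotient functor T : A → A/C preserves injective objects and injective hulls; consequently the global dimension of A/C is at most the global dimension of A. -/
open CategoryTheory CategoryTheory.Limits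

universe w w' v v' u u'

/-- `i : S ⟶ I` is an injective hull: `I` is injective, `i` is a monomorphism, and `i`
is essential: any `g` with `i ≫ g` mono is itself mono. -/
def IsInjectiveHull {A : Type u} [Category.{v} A] {S I : A} (i : S ⟶ I) : Prop :=
  Injective I ∧ Mono i ∧ ∀ (Y : A) (g : I ⟶ Y), Mono (i ≫ g) → Mono g

namespace CategoryTheory

section EssentialQuotient

variable {A : Type u} [Category.{v} A] [Abelian A] [IsGrothendieckAbelian.{v} A]

/-- The subobjects of `I` meeting `t : S ⟶ I` trivially have upper bounds along nonempty
chains. Here `M` meets `t` trivially when `S ⟶ I ⟶ I / M` is a monomorphism. -/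
lemma exists_subobject_upper_bound_of_isChain {S I : A} (t : S ⟶ I) (c : Set (Subobject I))
    (hc : ∀ M ∈ c, Mono (t ≫ cokernel.π M.arrow)) (hchain : IsChain (· ≤ ·) c)
    (hne : c.Nonempty) :
    ∃ N : Subobject I, Mono (t ≫ cokernel.π N.arrow) ∧ ∀ M ∈ c, M ≤ N := by
  have : Nonempty c := hne.to_subtype
  have : IsDirectedOrder c := ⟨hchain.directed⟩
  have : HasColimitsOfShape c A := hasColimitsOfShape_of_equivalence (equivSmallModel.{v} c).symm
  have : IsFiltered (SmallModel.{v} c) := IsFiltered.of_equivalence (equivSmallModel.{v} c)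
  have : HasExactColimitsOfShape c A :=
    HasExactColimitsOfShape.of_domain_equivalence A (equivSmallModel.{v} c).symm
  have : IsConnected c := IsFiltered.isConnected c
  let F : c ⥤ A :=
    { obj M := cokernel M.1.arrow
      map {M N} f := cokernel.desc _ (cokernel.π N.1.arrow) (by
        rw [← Subobject.ofLE_arrow (leOfHom f), Category.assoc, cokernel.condition, comp_zero]) }
  let π : (Functor.const c).obj I ⟶ F := { app M := cokernel.π M.1.arrow }
  obtain ⟨M₀⟩ := (inferInstance : Nonempty c)
  let q : I ⟶ colimit F := cokernel.π M₀.1.arrow ≫ colimit.ι F M₀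
  have hq (M : c) : cokernel.π M.1.arrow ≫ colimit.ι F M = q :=
    constant_of_preserves_morphisms (fun M : c ↦ π.app M ≫ colimit.ι F M)
      (fun M N f ↦ by
        rw [← colimit.w F f, ← π.naturality_assoc]
        exact Category.id_comp _) M M₀
  let φ : (Functor.const c).obj S ⟶ F := (Functor.const c).map t ≫ π
  have (M : c) : Mono (φ.app M) := hc M.1 M.2
  have : Mono φ := NatTrans.mono_of_mono_app φ
  have htq : Mono (t ≫ q) :=
    colim.map_mono' φ (isColimitConstCocone c S) (colimit.isColimit F) (t ≫ q) (fun M ↦ by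
      simp only [φ, π, constCocone_ι, Functor.const_map_app, NatTrans.id_app, colimit.cocone_ι,
        NatTrans.comp_app, Category.assoc, hq]
      exact Category.id_comp _)
  refine ⟨kernelSubobject q, ?_, fun M hM ↦ ?_⟩
  · have : (t ≫ cokernel.π (kernelSubobject q).arrow) ≫
        cokernel.desc _ q (kernelSubobject_arrow_comp q) = t ≫ q := by simp
    exact mono_of_mono_fac this
  · exact le_kernelSubobject _ _ (by simp [← hq ⟨M, hM⟩])

/-- Every monomorphism `t : S ⟶ I` in a Grothendieck abelian category becomes an essential
monomorphism after composition with a suitable epimorphism `I ⟶ Q`. -/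
lemma exists_epi_comp_essential {S I : A} (t : S ⟶ I) [Mono t] :
    ∃ (Q : A) (p : I ⟶ Q), Epi p ∧ Mono (t ≫ p) ∧
      ∀ (Z : A) (g : Q ⟶ Z), Mono ((t ≫ p) ≫ g) → Mono g := by
  obtain ⟨M, -, hM⟩ := zorn_le_nonempty₀ {M : Subobject I | Mono (t ≫ cokernel.π M.arrow)}
    (fun c hc hchain M hM ↦ exists_subobject_upper_bound_of_isChain t c hc hchain ⟨M, hM⟩) ⊥ (by
      have : IsIso (cokernel.π (⊥ : Subobject I).arrow) := by
        have h : (⊥ : Subobject I).arrow = 0 := Subobject.bot_arrow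
        rw [h]
        infer_instance
      exact mono_comp _ _)
  refine ⟨_, cokernel.π M.arrow, inferInstance, hM.1, fun Z g hg ↦ ?_⟩
  let h := cokernel.π M.arrow ≫ g
  have hmem : Mono (t ≫ cokernel.π (kernelSubobject h).arrow) := by
    have : (t ≫ cokernel.π (kernelSubobject h).arrow) ≫
        cokernel.desc _ h (kernelSubobject_arrow_comp h) =
        (t ≫ cokernel.π M.arrow) ≫ g := by simp [h]
    exact mono_of_mono_fac this
  have hle : kernelSubobject h ≤ M := hM.2 hmem (le_kernelSubobject _ _ (by simp [h]))
  refine Preadditive.mono_of_cancel_zero _ fun {W} y hy ↦ ?_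
  obtain ⟨W', e, _, x, hx⟩ := surjective_up_to_refinements_of_epi (cokernel.π M.arrow) y
  have hxh : x ≫ h = 0 := by
    rw [← Category.assoc, ← hx, Category.assoc, hy, comp_zero]
  rw [← cancel_epi e, hx, comp_zero, ← factorThruKernelSubobject_comp_arrow h x hxh,
    ← Subobject.ofLE_arrow hle]
  simp only [Category.assoc, cokernel.condition, comp_zero]

end EssentialQuotient

/-- Pulling back a monomorphism `p : P ⟶ I` along an essential morphism `i : X ⟶ I` yields an
essential morphism to `P`. -/
lemma essential_pullback_fst {A : Type u} [Category.{v} A] [Abelian A] {X I P : A} (i : X ⟶ I)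
    (hi : ∀ (Y : A) (g : I ⟶ Y), Mono (i ≫ g) → Mono g) (p : P ⟶ I) [Mono p]
    (Z : A) (g : P ⟶ Z) (hg : Mono (pullback.fst p i ≫ g)) : Mono g := by
  let l : kernel g ⟶ I := kernel.ι g ≫ p
  have hl : Mono (cokernel.π l) := by
    refine hi _ _ (Preadditive.mono_of_cancel_zero _ fun {W} b hb ↦ ?_)
    let a : W ⟶ kernel g := Abelian.monoLift l (b ≫ i) (by simpa using hb)
    have ha : (a ≫ kernel.ι g) ≫ p = b ≫ i := by
      simpa [l] using Abelian.monoLift_comp l (b ≫ i) (by simpa using hb)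
    have hz : pullback.lift _ _ ha = 0 := by
      rw [← cancel_mono (pullback.fst p i ≫ g), pullback.lift_fst_assoc, Category.assoc,
        kernel.condition, comp_zero, zero_comp]
    rw [← pullback.lift_snd _ _ ha, hz, zero_comp]
  have hl0 : l = 0 := by
    rw [← cancel_mono (cokernel.π l), cokernel.condition, zero_comp]
  refine Preadditive.mono_of_kernel_zero ?_
  rw [← cancel_mono p, zero_comp]
  exact hl0

lemma Adjunction.isIso_map_unit_app {A : Type u} [Category.{v} A] {B : Type u'} [Category.{v'} B]
    {T : A ⥤ B} {R : B ⥤ A} (adj : T ⊣ R) [R.Full] [R.Faithful] (X : A) :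
    IsIso (T.map (adj.unit.app X)) := by
  have h := adj.left_triangle_components X
  have : IsIso (T.map (adj.unit.app X) ≫ adj.counit.app (T.obj X)) := by
    rw [h]
    exact IsIso.id _
  exact IsIso.of_isIso_comp_right _ (adj.counit.app (T.obj X))

section Quotient

variable {A : Type u} [Category.{v} A] [Abelian A] {B : Type u'} [Category.{v'} B] [Abelian B]
  {T : A ⥤ B} {R : B ⥤ A}

lemma Adjunction.eq_zero_of_isZero_obj (adj : T ⊣ R) [T.Additive] {P : A} {Z : B}
    (hP : IsZero (T.obj P)) (f : P ⟶ R.obj Z) : f = 0 :=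
  (adj.homEquiv _ _).symm.injective (hP.eq_of_src _ _)

lemma Adjunction.comp_unit_eq_zero (adj : T ⊣ R) [T.Additive] {P I : A}
    (hP : IsZero (T.obj P)) (f : P ⟶ I) : f ≫ adj.unit.app I = 0 :=
  adj.eq_zero_of_isZero_obj hP _

variable [PreservesFiniteLimits T] [R.Full] [R.Faithful]

lemma Adjunction.isZero_obj_kernel_unit (adj : T ⊣ R) [T.Additive] (I : A) :
    IsZero (T.obj (kernel (adj.unit.app I))) := by
  have := adj.isIso_map_unit_app I
  have h : T.map (kernel.ι (adj.unit.app I)) = 0 := by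
    rw [← cancel_mono (T.map (adj.unit.app I)), ← T.map_comp, kernel.condition, T.map_zero,
      zero_comp]
  exact IsZero.of_mono_eq_zero _ h

/-- If the kernel of a quotient functor `T` with section functor `R` is stable, then an injective
object `I` has `R (T I)` as a retract. -/
lemma Adjunction.exists_section_unit_app [IsGrothendieckAbelian.{v} A] (adj : T ⊣ R) [T.Additive]
    (hstable : ∀ (X Y : A) (i : X ⟶ Y), Mono i →
      (∀ (Z : A) (g : Y ⟶ Z), Mono (i ≫ g) → Mono g) →
      IsZero (T.obj X) → IsZero (T.obj Y))
    (I : A) [Injective I] : ∃ s : R.obj (T.obj I) ⟶ I, s ≫ adj.unit.app I = 𝟙 _ := by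
  let η : I ⟶ R.obj (T.obj I) := adj.unit.app I
  obtain ⟨Q, p, _, hmono, hess⟩ := exists_epi_comp_essential (kernel.ι η)
  have hQ : IsZero (T.obj Q) := hstable _ _ _ hmono hess (adj.isZero_obj_kernel_unit I)
  let f : Q ⟶ I := Injective.factorThru (kernel.ι η) (kernel.ι η ≫ p)
  have hf : kernel.ι η ≫ p ≫ f = kernel.ι η := by
    rw [← Category.assoc]
    exact Injective.comp_factorThru (kernel.ι η) (kernel.ι η ≫ p)
  have hfη : f ≫ η = 0 := adj.comp_unit_eq_zero hQ f
  let S := ShortComplex.mk (kernel.ι η) η (kernel.condition η)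
  have hS : S.Exact := ShortComplex.exact_kernel η
  have h0 : S.f ≫ (𝟙 I - p ≫ f) = 0 := by simp [S, Preadditive.comp_sub, hf]
  refine ⟨hS.descToInjective _ h0, ?_⟩
  obtain ⟨f', hf'⟩ := R.map_surjective (hS.descToInjective _ h0 ≫ η)
  have h : η ≫ R.map f' = η ≫ R.map (𝟙 _) := by
    have := hS.comp_descToInjective _ h0
    dsimp only [S] at this
    rw [hf', reassoc_of% this, Preadditive.sub_comp, Category.assoc, hfη]
    simp
  have : f' = 𝟙 _ := (adj.homEquiv _ _).injective (by simpa only [adj.homEquiv_unit] using h)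
  rw [← R.map_id, ← this]
  exact hf'.symm

lemma Adjunction.injective_obj [IsGrothendieckAbelian.{v} A] (adj : T ⊣ R) [T.Additive]
    (hstable : ∀ (X Y : A) (i : X ⟶ Y), Mono i →
      (∀ (Z : A) (g : Y ⟶ Z), Mono (i ≫ g) → Mono g) →
      IsZero (T.obj X) → IsZero (T.obj Y))
    (I : A) [Injective I] : Injective (T.obj I) := by
  obtain ⟨s, hs⟩ := adj.exists_section_unit_app hstable I
  exact adj.injective_of_map_injective _ (Retract.injective ⟨s, adj.unit.app I, hs⟩)

/-- A quotient functor with stable kernel preserves essential monomorphisms. -/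
lemma Adjunction.essential_map (adj : T ⊣ R) [T.Additive]
    (hstable : ∀ (X Y : A) (i : X ⟶ Y), Mono i →
      (∀ (Z : A) (g : Y ⟶ Z), Mono (i ≫ g) → Mono g) →
      IsZero (T.obj X) → IsZero (T.obj Y))
    {X I : A} (i : X ⟶ I) [Mono i] (hi : ∀ (Y : A) (g : I ⟶ Y), Mono (i ≫ g) → Mono g)
    (Y : B) (g : T.obj I ⟶ Y) (hg : Mono (T.map i ≫ g)) : Mono g := by
  have := adj.isRightAdjoint
  have := adj.isIso_map_unit_app I
  let k := R.map (kernel.ι g)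
  let η := adj.unit.app I
  have sq : IsPullback (pullback.fst k η) (pullback.snd k η) k η := IsPullback.of_hasPullback k η
  let p : pullback k η ⟶ I := pullback.snd k η
  have hp : T.map p ≫ g = 0 := by
    have : T.map p = (adj.homEquiv _ _).symm (pullback.fst k η) ≫ kernel.ι g := by
      apply (adj.homEquiv _ _).injective
      rw [adj.homEquiv_naturality_right, Equiv.apply_symm_apply, adj.homEquiv_unit,
        adj.unit_naturality]
      exact sq.w.symm
    rw [this, Category.assoc, kernel.condition, comp_zero]
  have hX : IsZero (T.obj (pullback p i)) := by
    refine IsZero.of_mono_eq_zero (T.map (pullback.snd p i)) ?_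
    rw [← cancel_mono (T.map i ≫ g), zero_comp, ← T.map_comp_assoc, ← pullback.condition,
      T.map_comp_assoc, hp, comp_zero]
  have hP : IsZero (T.obj (pullback k η)) :=
    hstable _ _ (pullback.fst p i) inferInstance (essential_pullback_fst i hi p) hX
  have : IsIso (T.map (pullback.fst k η)) := (sq.map T).isIso_fst_of_isIso
  have hK : IsZero (kernel g) :=
    (hP.of_iso (asIso (T.map (pullback.fst k η))).symm).of_iso
      (asIso (adj.counit.app (kernel g))).symm
  exact Preadditive.mono_of_kernel_zero (hK.eq_of_src _ _)

end Quotient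

/-- An exact functor preserving injective objects does not increase injective dimensions. -/
lemma Functor.hasInjectiveDimensionLT_obj {A : Type u} [Category.{v} A] [Abelian A]
    [EnoughInjectives A] {B : Type u'} [Category.{v'} B] [Abelian B] (T : A ⥤ B) [T.Additive]
    [PreservesFiniteLimits T] [PreservesFiniteColimits T]
    (hT : ∀ I : A, Injective I → Injective (T.obj I)) (n : ℕ) (X : A)
    [HasInjectiveDimensionLT X n] : HasInjectiveDimensionLT (T.obj X) n := by
  induction n generalizing X with
  | zero =>
    exact (T.map_isZero (isZero_of_hasInjectiveDimensionLT_zero X)).hasInjectiveDimensionLT_zero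
  | succ n ih =>
    obtain _ | n := n
    · have := hT X (injective_iff_hasInjectiveDimensionLT_one.2 ‹_›)
      infer_instance
    · let S := ShortComplex.mk (Injective.ι X) (cokernel.π _) (cokernel.condition _)
      have hS : S.ShortExact := { exact := ShortComplex.exact_cokernel _ }
      have : HasInjectiveDimensionLT S.X₃ (n + 1) :=
        (hS.hasInjectiveDimensionLT_X₃_iff n (inferInstanceAs (Injective (Injective.under X)))).2
          ‹_›
      exact ((hS.map_of_exact T).hasInjectiveDimensionLT_X₃_iff n (hT _
        (inferInstanceAs (Injective (Injective.under X))))).1 (ih S.X₃)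

end CategoryTheory

/-- Let `A` be a Grothendieck category (abelian, AB5, with a generator) and let
`T : A ⥤ B` be the quotient functor by a localizing subcategory (an exact functor with
a fully faithful right adjoint), whose kernel is stable (closed under essential
extensions).  Then `T` preserves injective objects and injective hulls, and the global
dimension of `B = A/C` is at most that of `A` (global dimension being expressed by
vanishing of Ext groups). -/
theorem quotient_by_stable_localizing_preserves_injectives
    (A : Type u) [Category.{v} A] [Abelian A] [HasColimits A]
    [HasFilteredColimits A] [AB5 A] (G : A) (hG : IsSeparator G)
    [HasExt.{w} A]
    (B : Type u') [Category.{v'} B] [Abelian B] [HasExt.{w'} B]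
    (T : A ⥤ B) [T.Additive] [PreservesFiniteLimits T] [PreservesFiniteColimits T]
    (R : B ⥤ A) (adj : T ⊣ R) [R.Full] [R.Faithful]
    (hstable : ∀ (X Y : A) (i : X ⟶ Y), Mono i →
      (∀ (Z : A) (g : Y ⟶ Z), Mono (i ≫ g) → Mono g) →
      IsZero (T.obj X) → IsZero (T.obj Y)) :
    (∀ I : A, Injective I → Injective (T.obj I)) ∧
    (∀ (X I : A) (i : X ⟶ I), IsInjectiveHull i → IsInjectiveHull (T.map i)) ∧
    (∀ n : ℕ,
      (∀ (X Y : A) (m : ℕ), n < m → Subsingleton (Abelian.Ext.{w} X Y m)) →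
      (∀ (X Y : B) (m : ℕ), n < m → Subsingleton (Abelian.Ext.{w'} X Y m))) := by
  have : HasSeparator A := ⟨G, hG⟩
  have : IsGrothendieckAbelian.{v} A := {}
  have hT (I : A) (hI : Injective I) : Injective (T.obj I) := adj.injective_obj hstable I
  refine ⟨hT, fun X I i ⟨hI, hi, hess⟩ ↦ ⟨hT I hI, inferInstance, fun Y g hg ↦
    adj.essential_map hstable i hess Y g hg⟩, fun n hA X Y m hm ↦ ?_⟩
  have : HasInjectiveDimensionLT (R.obj Y) (n + 1) := .mk fun m hm Z e ↦
    (hA Z (R.obj Y) m hm).elim _ _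
  have : HasInjectiveDimensionLT ((R ⋙ T).obj Y) (n + 1) :=
    T.hasInjectiveDimensionLT_obj hT (n + 1) (R.obj Y)
  have : HasInjectiveDimensionLT Y (n + 1) :=
    hasInjectiveDimensionLT_of_iso (asIso (adj.counit.app Y)) _
  exact HasInjectiveDimensionLT.subsingleton Y (n + 1) m hm X
end
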